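/- Let G be a group. Then G is not amenable (i.e., G admits no left-invariant mean) if and only if there exists a subset A ⊆ G such that both A and its complement G ∖ A are strongly completely syndetic. -/

import Mathlib

open Classical in
/-- `A ⊆ G` is strongly completely syndetic if for every `ε > 0` there is a finite set
`F ⊆ G` such that for every finite multiset `K` of elements of `G` there is `f ∈ F` with
`|f·K ∩ A| ≥ (1 - ε)·|K|`, counting with multiplicity. -/
def StronglyCompletelySyndetic {G : Type*} [Group G] (A : Set G) : Prop :=
  ∀ ε : ℝ, 0 < ε → ∃ F : Finset G, ∀ K : Multiset G, ∃ f ∈ F,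
    (1 - ε) * (Multiset.card K : ℝ) ≤
      (Multiset.card ((K.map (fun x => f * x)).filter (fun x => x ∈ A)) : ℝ)

/-- A real-valued function on `S` is bounded if its absolute value admits a uniform bound. -/
def IsBddFun {S : Type*} (f : S → ℝ) : Prop :=
  ∃ C : ℝ, ∀ s, |f s| ≤ C

/-- `m` is a mean on `S`: a (real linear, positive, unital) functional on the space of
bounded real-valued functions on `S`; we encode it as a functional on all functions whose
behaviour is constrained only on bounded functions. -/
def IsMean {S : Type*} (m : (S → ℝ) → ℝ) : Prop :=
  (∀ f g : S → ℝ, IsBddFun f → IsBddFun g → m (f + g) = m f + m g) ∧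
  (∀ (c : ℝ) (f : S → ℝ), IsBddFun f → m (c • f) = c * m f) ∧
  (∀ f : S → ℝ, IsBddFun f → (∀ s, 0 ≤ f s) → 0 ≤ m f) ∧
  m (fun _ => 1) = 1

section Mean

variable {S : Type*}

lemma IsBddFun.add {f g : S → ℝ} (hf : IsBddFun f) (hg : IsBddFun g) : IsBddFun (f + g) := by
  obtain ⟨C, hC⟩ := hf
  obtain ⟨D, hD⟩ := hg
  exact ⟨C + D, fun s => (abs_add_le _ _).trans (add_le_add (hC s) (hD s))⟩

lemma IsBddFun.smul (c : ℝ) {f : S → ℝ} (hf : IsBddFun f) : IsBddFun (c • f) := by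
  obtain ⟨C, hC⟩ := hf
  refine ⟨|c| * C, fun s => ?_⟩
  rw [Pi.smul_apply, smul_eq_mul, abs_mul]
  exact mul_le_mul_of_nonneg_left (hC s) (abs_nonneg c)

lemma IsBddFun.comp {T : Type*} {f : S → ℝ} (hf : IsBddFun f) (φ : T → S) :
    IsBddFun (fun t => f (φ t)) :=
  hf.imp fun _ hC t => hC (φ t)

lemma isBddFun_const (c : ℝ) : IsBddFun (fun _ : S => c) := ⟨|c|, fun _ => le_rfl⟩

lemma isBddFun_ite (p : S → Prop) [DecidablePred p] :
    IsBddFun (fun s => if p s then (1 : ℝ) else 0) :=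
  ⟨1, fun s => by dsimp only; split_ifs <;> simp⟩

lemma isBddFun_indicator (A : Set S) : IsBddFun (A.indicator (1 : S → ℝ)) :=
  ⟨1, fun s => by by_cases h : s ∈ A <;> simp [h]⟩

lemma isBddFun_sum {ι : Type*} (s : Finset ι) {f : ι → S → ℝ} (hf : ∀ i ∈ s, IsBddFun (f i)) :
    IsBddFun (∑ i ∈ s, f i) :=
  Finset.sum_induction f IsBddFun (fun _ _ => IsBddFun.add) (isBddFun_const 0) hf

namespace IsMean

variable {m : (S → ℝ) → ℝ}

lemma map_zero (hm : IsMean m) : m 0 = 0 := by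
  simpa using hm.2.1 0 0 (isBddFun_const 0)

lemma map_sum (hm : IsMean m) {ι : Type*} (s : Finset ι) {f : ι → S → ℝ}
    (hf : ∀ i ∈ s, IsBddFun (f i)) : m (∑ i ∈ s, f i) = ∑ i ∈ s, m (f i) := by
  classical
  induction s using Finset.induction_on with
  | empty => simpa using hm.map_zero
  | insert a s ha ih =>
    have hs : ∀ i ∈ s, IsBddFun (f i) := fun i hi => hf i (Finset.mem_insert_of_mem hi)
    rw [Finset.sum_insert ha, Finset.sum_insert ha,
      hm.1 _ _ (hf a (Finset.mem_insert_self a s)) (isBddFun_sum s hs), ih hs]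

lemma mono (hm : IsMean m) {f g : S → ℝ} (hf : IsBddFun f) (hg : IsBddFun g)
    (hfg : ∀ s, f s ≤ g s) : m f ≤ m g := by
  have h := hm.2.2.1 (g + (-1 : ℝ) • f) (hg.add (hf.smul _)) fun s => by simpa using hfg s
  rw [hm.1 _ _ hg (hf.smul _), hm.2.1 _ _ hf] at h
  linarith

lemma map_const (hm : IsMean m) (c : ℝ) : m (fun _ => c) = c := by
  have h := hm.2.1 c (fun _ => 1) (isBddFun_const 1)
  rw [hm.2.2.2, mul_one] at h
  have e : (c • fun _ : S => (1 : ℝ)) = fun _ => c := by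
    ext
    simp
  rwa [e] at h

lemma abs_le (hm : IsMean m) {f : S → ℝ} {C : ℝ} (hC : ∀ s, |f s| ≤ C) : |m f| ≤ C := by
  have hf : IsBddFun f := ⟨C, hC⟩
  refine _root_.abs_le.2 ⟨?_, ?_⟩
  · rw [← hm.map_const (-C)]
    exact hm.mono (isBddFun_const _) hf fun s => (_root_.abs_le.1 (hC s)).1
  · rw [← hm.map_const C]
    exact hm.mono hf (isBddFun_const _) fun s => (_root_.abs_le.1 (hC s)).2

/-- A mean restricted to functions factoring through a map with finite range is a finite
weighted sum. -/
lemma map_comp_eq_sum (hm : IsMean m) {ι : Type*} [DecidableEq ι] (φ : S → ι) (P : Finset ι)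
    (hφ : ∀ s, φ s ∈ P) (h : ι → ℝ) :
    m (fun s => h (φ s)) = ∑ p ∈ P, h p * m (fun s => if φ s = p then 1 else 0) := by
  have e : (fun s => h (φ s)) = ∑ p ∈ P, h p • fun s => if φ s = p then (1 : ℝ) else 0 := by
    ext s
    simp [hφ s]
  rw [e, hm.map_sum _ fun p _ => (isBddFun_ite _).smul _]
  exact Finset.sum_congr rfl fun p _ => hm.2.1 _ _ (isBddFun_ite _)

open Classical in
/-- Finitely many values of a mean on indicator functions can be approximated from above by
counting in a finite multiset. -/
lemma exists_multiset_countP_le (hm : IsMean m) {ι : Type*} (F : Finset ι) (B : ι → Set S)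
    {ε : ℝ} (hε : 0 < ε) :
    ∃ K : Multiset S, K ≠ 0 ∧ ∀ f ∈ F, (K.countP (· ∈ B f) : ℝ) ≤
      (m ((B f).indicator 1) + ε) * Multiset.card K := by
  let φ : S → Finset ι := fun s => F.filter fun f => s ∈ B f
  let P := F.powerset
  have hφ : ∀ s, φ s ∈ P := fun s => Finset.mem_powerset.2 (Finset.filter_subset _ _)
  let w : Finset ι → ℝ := fun p => m (fun s => if φ s = p then 1 else 0)
  have hw : ∀ p, 0 ≤ w p := fun p =>
    hm.2.2.1 _ (isBddFun_ite _) fun s => by split_ifs <;> simp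
  have hw1 : ∑ p ∈ P, w p = 1 := by
    have h := hm.map_comp_eq_sum φ P hφ fun _ => 1
    rw [hm.2.2.2] at h
    simpa only [one_mul] using h.symm
  have hS : Nonempty S := by
    by_contra hS
    rw [not_nonempty_iff] at hS
    have h := hm.map_zero
    rw [Subsingleton.elim (0 : S → ℝ) fun _ => 1, hm.2.2.2] at h
    exact one_ne_zero h
  have hx : ∀ p, ∃ x, w p ≠ 0 → φ x = p := by
    intro p
    by_cases h : ∃ x, φ x = p
    · exact h.imp fun x hx _ => hx
    · refine ⟨hS.some, fun hp => absurd ?_ hp⟩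
      push Not at h
      simp only [w, h, if_false]
      exact hm.map_zero
  choose x hx using hx
  obtain ⟨N, hN⟩ := exists_nat_gt ((P.card : ℝ) / ε)
  rw [div_lt_iff₀ hε] at hN
  have hN0 : 0 < (N : ℝ) := by
    by_contra h
    have : (0 : ℝ) ≤ P.card := by positivity
    nlinarith
  let n : Finset ι → ℕ := fun p => ⌈N * w p⌉₊
  have hcard : (N : ℝ) ≤ Multiset.card (∑ p ∈ P, Multiset.replicate (n p) (x p)) := by
    rw [Multiset.card_sum]
    push_cast [Multiset.card_replicate]
    calc (N : ℝ) = ∑ p ∈ P, N * w p := by rw [← Finset.mul_sum, hw1, mul_one]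
      _ ≤ _ := Finset.sum_le_sum fun p _ => Nat.le_ceil _
  refine ⟨∑ p ∈ P, Multiset.replicate (n p) (x p), ?_, fun f hf => ?_⟩
  · intro h
    rw [h] at hcard
    simp at hcard
    simp [hcard] at hN0
  have hB : ∀ s, s ∈ B f ↔ f ∈ φ s := fun s => by simp [φ, hf]
  have hmB : m ((B f).indicator 1) = ∑ p ∈ P, (if f ∈ p then 1 else 0) * w p := by
    rw [← hm.map_comp_eq_sum φ P hφ fun p => if f ∈ p then 1 else 0]
    congr 1
    ext s
    simp only [Set.indicator_apply, hB, Pi.one_apply]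
  have hm0 : 0 ≤ m ((B f).indicator 1) :=
    hm.2.2.1 _ (isBddFun_indicator _) (Set.indicator_nonneg fun _ _ => zero_le_one)
  calc ((∑ p ∈ P, Multiset.replicate (n p) (x p)).countP (· ∈ B f) : ℝ)
      = ∑ p ∈ P, ((Multiset.replicate (n p) (x p)).countP (· ∈ B f) : ℝ) := by
        rw [← Multiset.coe_countPAddMonoidHom, _root_.map_sum]
        push_cast
        rfl
    _ ≤ ∑ p ∈ P, (N * ((if f ∈ p then 1 else 0) * w p) + 1) := by
        refine Finset.sum_le_sum fun p _ => ?_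
        rw [← Multiset.coe_replicate, Multiset.coe_countP, List.countP_replicate]
        by_cases hp : w p = 0
        · simp [n, hp]
        · simp only [hB, hx p hp]
          by_cases hfp : f ∈ p
          · simp only [hfp, decide_true, if_true, one_mul]
            exact (Nat.ceil_lt_add_one (mul_nonneg hN0.le (hw p))).le
          · simp [hfp]
    _ = N * m ((B f).indicator 1) + P.card := by
        rw [Finset.sum_add_distrib, ← Finset.mul_sum, hmB]
        simp
    _ ≤ (m ((B f).indicator 1) + ε) * N := by linarith
    _ ≤ _ := mul_le_mul_of_nonneg_left hcard (by positivity)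

end IsMean

/-- The means on `S`, extended by zero to unbounded functions. -/
def normalizedMeans (S : Type*) : Set ((S → ℝ) → ℝ) :=
  {m | IsMean m ∧ ∀ f, ¬ IsBddFun f → m f = 0}

lemma isClosed_normalizedMeans : IsClosed (normalizedMeans S) := by
  simp only [normalizedMeans, IsMean, Set.ofPred_and, Set.ofPred_forall]
  refine ((isClosed_iInter fun f => isClosed_iInter fun g => isClosed_iInter fun _ =>
    isClosed_iInter fun _ => isClosed_eq (by fun_prop) (by fun_prop)).inter
    ((isClosed_iInter fun c => isClosed_iInter fun f => isClosed_iInter fun _ =>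
      isClosed_eq (by fun_prop) (by fun_prop)).inter
    ((isClosed_iInter fun f => isClosed_iInter fun _ => isClosed_iInter fun _ =>
      isClosed_le (by fun_prop) (by fun_prop)).inter
    (isClosed_eq (by fun_prop) (by fun_prop))))).inter
    (isClosed_iInter fun f => isClosed_iInter fun _ => isClosed_eq (by fun_prop) (by fun_prop))

lemma isCompact_normalizedMeans : IsCompact (normalizedMeans S) := by
  have h : ∀ f : S → ℝ, ∃ C : ℝ, ∀ m ∈ normalizedMeans S, |m f| ≤ C := by
    intro f
    by_cases hf : IsBddFun f
    · obtain ⟨C, hC⟩ := hf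
      exact ⟨C, fun m hm => hm.1.abs_le hC⟩
    · exact ⟨0, fun m hm => by simp [hm.2 f hf]⟩
  choose C hC using h
  exact (isCompact_univ_pi fun f => isCompact_Icc (a := -C f) (b := C f)).of_isClosed_subset
    isClosed_normalizedMeans fun m hm f _ => abs_le.1 (hC f m hm)

lemma convex_normalizedMeans : Convex ℝ (normalizedMeans S) := by
  rintro m ⟨⟨h1, h2, h3, h4⟩, h5⟩ m' ⟨⟨h1', h2', h3', h4'⟩, h5'⟩ a b ha hb hab
  refine ⟨⟨fun f g hf hg => ?_, fun c f hf => ?_, fun f hf hf0 => ?_, ?_⟩, fun f hf => ?_⟩ <;>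
    simp only [Pi.add_apply, Pi.smul_apply, smul_eq_mul]
  · rw [h1 f g hf hg, h1' f g hf hg]
    ring
  · rw [h2 c f hf, h2' c f hf]
    ring
  · have := h3 f hf hf0
    have := h3' f hf hf0
    positivity
  · rw [h4, h4']
    linarith
  · rw [h5 f hf, h5' f hf]
    simp

end Mean

section Group

variable {G : Type*} [Group G]

/-- A left-invariant mean gives full mass to every strongly completely syndetic set. -/
lemma StronglyCompletelySyndetic.one_le_mean {A : Set G} (hA : StronglyCompletelySyndetic A)
    {m : (G → ℝ) → ℝ} (hm : IsMean m)
    (hinv : ∀ (g : G) (f : G → ℝ), IsBddFun f → m (fun h => f (g * h)) = m f) :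
    1 ≤ m (A.indicator 1) := by
  classical
  refine le_of_forall_pos_le_add fun ε hε => ?_
  obtain ⟨F, hF⟩ := hA (ε / 2) (half_pos hε)
  obtain ⟨K, hK, hKF⟩ := hm.exists_multiset_countP_le F (fun f => {g | f * g ∈ A}) (half_pos hε)
  obtain ⟨f, hf, h⟩ := hF K
  have h' := hKF f hf
  rw [← Multiset.countP_eq_card_filter, Multiset.countP_map,
    ← Multiset.countP_eq_card_filter] at h
  have e : m (Set.indicator {g | f * g ∈ A} 1) = m (A.indicator 1) :=
    hinv f _ (isBddFun_indicator A)
  rw [e] at h'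
  have hK0 : 0 < (Multiset.card K : ℝ) := by
    exact_mod_cast Multiset.card_pos.2 hK
  have := le_of_mul_le_mul_right (h.trans h') hK0
  linarith

/-- The left translation action of a group on functionals. -/
def translateFunctional (g : G) (m : (G → ℝ) → ℝ) : (G → ℝ) → ℝ :=
  fun f => m (fun h => f (g * h))

lemma translateFunctional_mul (g k : G) (m : (G → ℝ) → ℝ) :
    translateFunctional g (translateFunctional k m) = translateFunctional (g * k) m := by
  ext f
  simp [translateFunctional, mul_assoc]

lemma translateFunctional_one (m : (G → ℝ) → ℝ) : translateFunctional 1 m = m := by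
  ext f
  simp [translateFunctional]

/-- Nonempty closed convex translation-invariant sets of normalized means. -/
structure IsInvariantMeanSet (Q : Set ((G → ℝ) → ℝ)) : Prop where
  subset : Q ⊆ normalizedMeans G
  nonempty : Q.Nonempty
  isClosed : IsClosed Q
  convex : Convex ℝ Q
  translate_mem : ∀ g, ∀ m ∈ Q, translateFunctional g m ∈ Q

open Classical in
lemma normalizedMeans_nonempty : (normalizedMeans G).Nonempty := by
  refine ⟨fun f => if IsBddFun f then f 1 else 0, ⟨fun f g hf hg => ?_, fun c f hf => ?_,
    fun f hf hf0 => ?_, ?_⟩, fun f hf => ?_⟩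
  · simp [hf, hg, hf.add hg]
  · simp [hf, hf.smul c]
  · simpa [hf] using hf0 1
  · simp [isBddFun_const]
  · simp [hf]

lemma translateFunctional_mem_normalizedMeans (g : G) {m : (G → ℝ) → ℝ}
    (hm : m ∈ normalizedMeans G) : translateFunctional g m ∈ normalizedMeans G := by
  obtain ⟨⟨h1, h2, h3, h4⟩, h5⟩ := hm
  refine ⟨⟨fun f f' hf hf' => h1 _ _ (hf.comp _) (hf'.comp _), fun c f hf => h2 c _ (hf.comp _),
    fun f hf hf0 => h3 _ (hf.comp _) fun _ => hf0 _, h4⟩, fun f hf => h5 _ fun hf' => hf ?_⟩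
  simpa using hf'.comp (g⁻¹ * ·)

lemma isInvariantMeanSet_normalizedMeans : IsInvariantMeanSet (normalizedMeans G) :=
  ⟨subset_rfl, normalizedMeans_nonempty, isClosed_normalizedMeans, convex_normalizedMeans,
    fun g _ => translateFunctional_mem_normalizedMeans g⟩

lemma IsInvariantMeanSet.isCompact {Q : Set ((G → ℝ) → ℝ)} (hQ : IsInvariantMeanSet Q) :
    IsCompact Q :=
  isCompact_normalizedMeans.of_isClosed_subset hQ.isClosed hQ.subset

lemma exists_minimal_isInvariantMeanSet (G : Type*) [Group G] :
    ∃ Q : Set ((G → ℝ) → ℝ), Minimal IsInvariantMeanSet Q := by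
  suffices h : ∀ c ⊆ {Q : Set ((G → ℝ) → ℝ) | IsInvariantMeanSet Q}, IsChain (· ⊆ ·) c →
      c.Nonempty → IsInvariantMeanSet (⋂₀ c) by
    obtain ⟨Q, -, hQ⟩ := zorn_superset_nonempty _
      (fun c hc hchain hne => ⟨⋂₀ c, h c hc hchain hne, fun _ => Set.sInter_subset_of_mem⟩)
      _ isInvariantMeanSet_normalizedMeans
    exact ⟨Q, hQ⟩
  refine fun c hc hchain hne => ⟨?_, ?_, ?_, ?_, ?_⟩
  · obtain ⟨s, hs⟩ := hne
    exact (Set.sInter_subset_of_mem hs).trans (hc hs).subset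
  · have := hne.to_subtype
    have hdir : DirectedOn (fun s t : Set ((G → ℝ) → ℝ) => s ⊇ t) c :=
      fun s hs t ht => (hchain.total hs ht).elim
        (fun h => ⟨s, hs, subset_rfl, h⟩) fun h => ⟨t, ht, h, subset_rfl⟩
    exact IsCompact.nonempty_sInter_of_directed_nonempty_isCompact_isClosed hdir
      (fun s hs => (hc hs).nonempty) (fun s hs => (hc hs).isCompact)
      fun s hs => (hc hs).isClosed
  · exact isClosed_sInter fun s hs => (hc hs).isClosed
  · exact convex_sInter fun s hs => (hc hs).convex
  · exact fun g m hm s hs => (hc hs).translate_mem g m (hm s hs)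

lemma IsInvariantMeanSet.exists_average {Q : Set ((G → ℝ) → ℝ)} (hQ : IsInvariantMeanSet Q)
    {m : (G → ℝ) → ℝ} (hm : m ∈ Q) (K : Multiset G) :
    ∃ q ∈ Q, ∀ f, Multiset.card K * q f = (K.map fun k => translateFunctional k m f).sum := by
  induction K using Multiset.induction_on with
  | empty => exact ⟨m, hm, by simp⟩
  | cons k K ih =>
    obtain ⟨q, hq, h⟩ := ih
    have hpos : (0 : ℝ) < Multiset.card K + 1 := by positivity
    refine ⟨(Multiset.card K / (Multiset.card K + 1) : ℝ) • q +
      (1 / (Multiset.card K + 1) : ℝ) • translateFunctional k m,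
      hQ.convex hq (hQ.translate_mem k m hm) (by positivity) (by positivity) (by field_simp),
      fun f => ?_⟩
    rw [Multiset.map_cons, Multiset.sum_cons, ← h f, Multiset.card_cons]
    simp only [Pi.add_apply, Pi.smul_apply, smul_eq_mul]
    push_cast
    field_simp
    ring

lemma exists_translate_gt_of_minimal {Q : Set ((G → ℝ) → ℝ)} (hQ : Minimal IsInvariantMeanSet Q)
    {f : G → ℝ} {p q : (G → ℝ) → ℝ} (hp : p ∈ Q) (hq : q ∈ Q) {c : ℝ} (hc : c < p f) :
    ∃ g, c < translateFunctional g q f := by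
  by_contra! h
  let R : Set ((G → ℝ) → ℝ) := Q ∩ {r | ∀ g, translateFunctional g r f ≤ c}
  have hR : IsInvariantMeanSet R := by
    refine ⟨Set.inter_subset_left.trans hQ.prop.subset, ⟨q, hq, h⟩, hQ.prop.isClosed.inter ?_,
      hQ.prop.convex.inter ?_, fun g r hr => ⟨hQ.prop.translate_mem g r hr.1, fun k => ?_⟩⟩
    · simp only [Set.ofPred_forall, translateFunctional]
      exact isClosed_iInter fun g => isClosed_le (by fun_prop) (by fun_prop)
    · intro r hr s hs a b ha hb hab g
      have h1 := mul_le_mul_of_nonneg_left (hr g) ha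
      have h2 := mul_le_mul_of_nonneg_left (hs g) hb
      have h3 : a * c + b * c = c := by rw [← add_mul, hab, one_mul]
      simp only [translateFunctional, Pi.add_apply, Pi.smul_apply, smul_eq_mul] at *
      linarith
    · rw [translateFunctional_mul]
      exact hr.2 _
  have hpR := (hQ.le_of_le hR Set.inter_subset_left hp).2 1
  rw [translateFunctional_one] at hpR
  exact absurd hpR (not_le.2 hc)

/-- Superlevel sets of a translate function `g ↦ (g • m) f`, with `m` in a minimal invariant set
of means, are strongly completely syndetic below the maximum. -/
lemma stronglyCompletelySyndetic_of_minimal {Q : Set ((G → ℝ) → ℝ)}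
    (hQ : Minimal IsInvariantMeanSet Q) {f : G → ℝ} {p m : (G → ℝ) → ℝ} (hp : p ∈ Q) (hm : m ∈ Q)
    {c : ℝ} (hc : c < p f) {A : Set G} (hA : ∀ g, c < translateFunctional g m f → g ∈ A) :
    StronglyCompletelySyndetic A := by
  classical
  intro ε hε
  obtain ⟨r, hr, hmax⟩ := hQ.prop.isCompact.exists_isMaxOn hQ.prop.nonempty
    (f := fun q => q f) (by fun_prop)
  replace hmax : ∀ q ∈ Q, q f ≤ r f := fun q hq => hmax hq
  have hcr : 0 < r f - c := sub_pos.2 (hc.trans_le (hmax p hp))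
  obtain ⟨F, hF⟩ := hQ.prop.isCompact.elim_finite_subcover
    (fun g => {q : (G → ℝ) → ℝ | r f - ε * (r f - c) < translateFunctional g q f})
    (fun g => isOpen_lt (by fun_prop) (by unfold translateFunctional; fun_prop))
    fun q hq => Set.mem_iUnion.2 <| exists_translate_gt_of_minimal hQ hr hq
      (sub_lt_self _ (mul_pos hε hcr))
  refine ⟨F, fun K => ?_⟩
  obtain ⟨q, hq, hqK⟩ := hQ.prop.exists_average hm K
  obtain ⟨g, hg, hgq⟩ := Set.mem_iUnion₂.1 (hF hq)
  refine ⟨g, hg, ?_⟩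
  have havg : Multiset.card K * translateFunctional g q f =
      (K.map fun k => translateFunctional (g * k) m f).sum := by
    simp only [← translateFunctional_mul]
    exact hqK _
  have hcount : ∀ L : Multiset G, (L.map fun k => translateFunctional (g * k) m f).sum ≤
      c * Multiset.card L + (r f - c) * L.countP (fun x => g * x ∈ A) := by
    intro L
    induction L using Multiset.induction_on with
    | empty => simp
    | cons k L ih =>
      rw [Multiset.map_cons, Multiset.sum_cons, Multiset.card_cons, Multiset.countP_cons]
      have h1 := hmax _ (hQ.prop.translate_mem (g * k) m hm)
      have h2 := hA (g * k)
      split_ifs with h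
      · push_cast
        linarith
      · have := not_lt.1 (mt h2 h)
        push_cast
        linarith
  rw [← Multiset.countP_eq_card_filter, Multiset.countP_map, ← Multiset.countP_eq_card_filter]
  have h1 := mul_le_mul_of_nonneg_left (le_of_lt hgq) (Nat.cast_nonneg (α := ℝ) (Multiset.card K))
  have h2 := hcount K
  refine le_of_mul_le_mul_left ?_ hcr
  linarith

end Group

/-- A group `G` is non-amenable (admits no left-invariant mean) iff there is a subset
`A ⊆ G` such that both `A` and `Aᶜ` are strongly completely syndetic. -/
theorem not_amenable_iff_stronglyCompletelySyndetic {G : Type*} [Group G] :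
    (¬ ∃ m : (G → ℝ) → ℝ, IsMean m ∧
        ∀ (g : G) (f : G → ℝ), IsBddFun f → m (fun h => f (g * h)) = m f) ↔
      ∃ A : Set G, StronglyCompletelySyndetic A ∧ StronglyCompletelySyndetic Aᶜ := by
  classical
  constructor
  · intro hG
    obtain ⟨Q, hQ⟩ := exists_minimal_isInvariantMeanSet G
    obtain ⟨m, hm⟩ := hQ.prop.nonempty
    have hmean : ∀ q ∈ Q, IsMean q := fun q hq => (hQ.prop.subset hq).1
    obtain ⟨p, hp, q, hq, f, hf, hpq⟩ :
        ∃ p ∈ Q, ∃ q ∈ Q, ∃ f, IsBddFun f ∧ p f < q f := by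
      by_contra! h
      exact hG ⟨m, hmean m hm, fun g f hf =>
        (h m hm _ (hQ.prop.translate_mem g m hm) f hf).antisymm
          (h _ (hQ.prop.translate_mem g m hm) m hm f hf)⟩
    obtain ⟨c, hpc, hcq⟩ := exists_between hpq
    have hneg : ∀ r ∈ Q, r ((-1 : ℝ) • f) = -r f := fun r hr => by
      rw [(hmean r hr).2.1 _ _ hf, neg_one_mul]
    refine ⟨{g | c < translateFunctional g m f},
      stronglyCompletelySyndetic_of_minimal hQ hq hm hcq fun _ => id,
      stronglyCompletelySyndetic_of_minimal hQ (f := (-1 : ℝ) • f) hp hm (c := -c) ?_ ?_⟩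
    · rw [hneg p hp]
      exact neg_lt_neg hpc
    · intro g hg
      rw [hneg _ (hQ.prop.translate_mem g m hm)] at hg
      exact not_lt.2 (neg_lt_neg_iff.1 hg).le
  · rintro ⟨A, hA, hA'⟩ ⟨m, hm, hinv⟩
    have h1 := hA.one_le_mean hm hinv
    have h2 := hA'.one_le_mean hm hinv
    have h3 := hm.1 _ _ (isBddFun_indicator A) (isBddFun_indicator Aᶜ)
    rw [Set.indicator_self_add_compl] at h3
    have h4 : m 1 = 1 := hm.2.2.2
    linarith
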